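/- Every invertible matrix A ∈ GL₃(ℂ) admits a singular value decomposition A = R₁ D R₂ᵀ with R₁, R₂ ∈ O₃(ℂ) complex orthogonal and D a matrix whose square D² is in symmetric Jordan form with non-isotropic kernel condition (i.e. D² is a symmetric Jordan matrix and D is symmetric with DᵀD = D²). -/

import Mathlib

open Matrix

noncomputable def f1 : Fin 3 → ℂ := (Real.sqrt 2 : ℂ)⁻¹ • ![1, -Complex.I, 0]
def e3 : Fin 3 → ℂ := ![0, 0, 1]

/-- The symmetric Jordan block `J₂ = f₁f₁ᵀ`. -/
noncomputable def J2 : Matrix (Fin 3) (Fin 3) ℂ := vecMulVec f1 f1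

/-- The symmetric Jordan block `J₃ = f₁e₃ᵀ + e₃f₁ᵀ`. -/
noncomputable def J3 : Matrix (Fin 3) (Fin 3) ℂ := vecMulVec f1 e3 + vecMulVec e3 f1

/-- `M` is in symmetric Jordan form. -/
def IsSymmetricJordan (M : Matrix (Fin 3) (Fin 3) ℂ) : Prop :=
  (∃ a₁ a₂ a₃ : ℂ, M = Matrix.diagonal ![a₁, a₂, a₃]) ∨
  (∃ a b : ℂ, M = Matrix.diagonal ![a, a, b] + J2) ∨
  (∃ a : ℂ, M = a • (1 : Matrix (Fin 3) (Fin 3) ℂ) + J3)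

/-- `S` is conjugate to a symmetric Jordan matrix by a complex orthogonal matrix. -/
def HasOrthogonalJordanForm (S : Matrix (Fin 3) (Fin 3) ℂ) : Prop :=
  ∃ R : Matrix (Fin 3) (Fin 3) ℂ, Rᵀ * R = 1 ∧ IsSymmetricJordan (Rᵀ * S * R)

theorem HasOrthogonalJordanForm.of_conj {S R : Matrix (Fin 3) (Fin 3) ℂ} (hR : Rᵀ * R = 1)
    (h : HasOrthogonalJordanForm (Rᵀ * S * R)) : HasOrthogonalJordanForm S := by
  obtain ⟨Q, hQ, hJ⟩ := h
  refine ⟨R * Q, ?_, ?_⟩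
  · calc (R * Q)ᵀ * (R * Q) = Qᵀ * (Rᵀ * R) * Q := by simp only [transpose_mul, Matrix.mul_assoc]
      _ = 1 := by rw [hR, Matrix.mul_one, hQ]
  · simpa only [transpose_mul, Matrix.mul_assoc] using hJ

theorem sqrt_two_inv_mul_self : (Real.sqrt 2 : ℂ)⁻¹ * (Real.sqrt 2 : ℂ)⁻¹ = 1 / 2 := by
  rw [← mul_inv, ← Complex.ofReal_mul, Real.mul_self_sqrt (by norm_num)]
  norm_num

theorem J2_eq : J2 = (1 / 2 : ℂ) • !![1, -Complex.I, 0; -Complex.I, -1, 0; 0, 0, 0] := by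
  have h := sqrt_two_inv_mul_self
  have hI := Complex.I_mul_I
  ext i j
  fin_cases i <;> fin_cases j <;> simp [J2, f1, vecMulVec_apply] <;> grind

theorem J3_eq : J3 =
    (Real.sqrt 2 : ℂ)⁻¹ • !![0, 0, 1; 0, 0, -Complex.I; 1, -Complex.I, 0] := by
  ext i j
  fin_cases i <;> fin_cases j <;> simp [J3, f1, e3]

theorem transpose_J2 : J2ᵀ = J2 := by
  simp [J2, transpose_vecMulVec]

theorem transpose_J3 : J3ᵀ = J3 := by
  simp [J3, transpose_vecMulVec, add_comm]

theorem J2_mul_J2 : J2 * J2 = 0 := by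
  have hI := Complex.I_mul_I
  rw [J2_eq]
  ext i j
  fin_cases i <;> fin_cases j <;> simp [Matrix.mul_apply, Fin.sum_univ_three] <;> grind

theorem J3_mul_J3 : J3 * J3 = J2 := by
  have h := sqrt_two_inv_mul_self
  have hI := Complex.I_mul_I
  rw [J2_eq, J3_eq]
  ext i j
  fin_cases i <;> fin_cases j <;> simp [Matrix.mul_apply, Fin.sum_univ_three] <;> grind

theorem J3_mul_J2 : J3 * J2 = 0 := by
  have hI := Complex.I_mul_I
  rw [J2_eq, J3_eq]
  ext i j
  fin_cases i <;> fin_cases j <;> simp [Matrix.mul_apply, Fin.sum_univ_three] <;> grind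

theorem J2_mul_J3 : J2 * J3 = 0 := by
  simpa [transpose_J2, transpose_J3] using congrArg transpose J3_mul_J2

theorem IsSymmetricJordan.exists_symmetric_sqrt {M : Matrix (Fin 3) (Fin 3) ℂ}
    (hM : IsSymmetricJordan M) (hdet : M.det ≠ 0) :
    ∃ D : Matrix (Fin 3) (Fin 3) ℂ, Dᵀ = D ∧ D * D = M := by
  have hI := Complex.I_mul_I
  have sqrt_exists : ∀ z : ℂ, ∃ x : ℂ, x * x = z := fun z ↦ by
    obtain ⟨x, hx⟩ := IsAlgClosed.exists_pow_nat_eq z (n := 2) (by norm_num)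
    exact ⟨x, by rw [← sq, hx]⟩
  rcases hM with ⟨a, b, c, rfl⟩ | ⟨a, b, rfl⟩ | ⟨a, rfl⟩
  · obtain ⟨x, rfl⟩ := sqrt_exists a
    obtain ⟨y, rfl⟩ := sqrt_exists b
    obtain ⟨z, rfl⟩ := sqrt_exists c
    refine ⟨diagonal ![x, y, z], diagonal_transpose _, ?_⟩
    rw [diagonal_mul_diagonal]
    congr 1
    ext i
    fin_cases i <;> rfl
  · obtain ⟨x, rfl⟩ := sqrt_exists a
    obtain ⟨y, rfl⟩ := sqrt_exists b
    have hx : x ≠ 0 := by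
      rintro rfl
      apply hdet
      rw [J2_eq]
      simp [det_fin_three]
      grind
    refine ⟨diagonal ![x, x, y] + (2 * x)⁻¹ • J2, by simp [transpose_J2], ?_⟩
    have hcomm : diagonal ![x, x, y] * J2 = x • J2 ∧ J2 * diagonal ![x, x, y] = x • J2 := by
      rw [J2_eq]
      constructor <;> ext i j <;> fin_cases i <;> fin_cases j <;>
        simp [Matrix.mul_apply, diagonal_apply] <;> ring
    have hdiag : diagonal ![x, x, y] * diagonal ![x, x, y] =
        diagonal ![x * x, x * x, y * y] := by
      rw [diagonal_mul_diagonal]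
      congr 1
      ext i
      fin_cases i <;> rfl
    simp only [mul_add, add_mul, Matrix.smul_mul, Matrix.mul_smul, hcomm.1, hcomm.2, J2_mul_J2,
      hdiag, smul_zero, add_zero, add_assoc, ← add_smul, smul_smul]
    rw [show (2 * x)⁻¹ * x + (2 * x)⁻¹ * x = 1 by field_simp; norm_num, one_smul]
  · obtain ⟨x, rfl⟩ := sqrt_exists a
    have hx : x ≠ 0 := by
      rintro rfl
      apply hdet
      rw [J3_eq]
      simp [det_fin_three]
    refine ⟨x • 1 + (2 * x)⁻¹ • J3 + (-(8 * x ^ 3)⁻¹) • J2,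
      by simp [transpose_J2, transpose_J3], ?_⟩
    simp only [mul_add, add_mul, Matrix.smul_mul, Matrix.mul_smul, J2_mul_J2, J2_mul_J3, J3_mul_J2,
      J3_mul_J3, Matrix.mul_one, Matrix.one_mul, smul_zero, add_zero, smul_smul]
    match_scalars <;> field_simp <;> norm_num

/-- The Householder reflection swapping `v` and `w`. -/
theorem exists_orthogonal_mulVec_eq {n : Type*} [Fintype n] [DecidableEq n] {v w : n → ℂ}
    (h : v ⬝ᵥ v = w ⬝ᵥ w) (hne : (v - w) ⬝ᵥ (v - w) ≠ 0) :
    ∃ R : Matrix n n ℂ, Rᵀ * R = 1 ∧ R *ᵥ w = v := by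
  set u := v - w with hu
  have huw : u ⬝ᵥ u = -2 * (u ⬝ᵥ w) := by
    simp only [hu, sub_dotProduct, dotProduct_sub, h, dotProduct_comm w v]
    ring
  have huw' : u ⬝ᵥ w ≠ 0 := fun h0 ↦ hne (by rw [huw, h0, mul_zero])
  refine ⟨1 - (2 / (u ⬝ᵥ u)) • vecMulVec u u, ?_, ?_⟩
  · simp only [transpose_sub, transpose_one, transpose_smul, transpose_vecMulVec, mul_sub, sub_mul,
      Matrix.mul_one, Matrix.one_mul, Matrix.smul_mul, Matrix.mul_smul, vecMulVec_mul_vecMulVec,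
      vecMulVec_smul, smul_smul]
    match_scalars
    · rfl
    · field_simp
      ring
  · rw [sub_mulVec, one_mulVec, smul_mulVec, vecMulVec_mulVec, huw]
    ext i
    rw [show v i = w i + u i by simp [hu]]
    generalize u ⬝ᵥ w = d at huw'
    clear_value u
    simp
    field_simp
    ring

/-- A complex rotation in the first two coordinates scaling `f1` by an arbitrary unit. -/
theorem exists_rotation (t : ℂ) (ht : t ≠ 0) : ∃ c s : ℂ,
    c * c + s * s = 1 ∧ c + Complex.I * s = t ∧ (c - Complex.I * s) * t = 1 := by
  have hI := Complex.I_mul_I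
  refine ⟨(t + t⁻¹) / 2, -Complex.I * (t - t⁻¹) / 2, ?_, ?_, ?_⟩ <;> field_simp <;> grind

theorem rotation_orthogonal {c s : ℂ} (h : c * c + s * s = 1) :
    !![c, -s, 0; s, c, 0; 0, 0, 1]ᵀ * !![c, -s, 0; s, c, 0; 0, 0, 1] = 1 := by
  ext i j
  fin_cases i <;> fin_cases j <;> simp [Matrix.mul_apply, Fin.sum_univ_three] <;> grind

theorem hasOrthogonalJordanForm_of_block_isotropic (a k b : ℂ) :
    HasOrthogonalJordanForm
      !![a + k, -Complex.I * k, 0; -Complex.I * k, a - k, 0; 0, 0, b] := by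
  have hI := Complex.I_mul_I
  by_cases hk : k = 0
  · refine ⟨1, by simp, Or.inl ⟨a, a, b, ?_⟩⟩
    subst hk
    ext i j
    fin_cases i <;> fin_cases j <;> simp
  · obtain ⟨t, ht⟩ := IsAlgClosed.exists_pow_nat_eq (2 * k) (n := 2) (by norm_num)
    have ht0 : t ≠ 0 := by rintro rfl; apply hk; simpa using ht.symm
    obtain ⟨c, s, h1, h2, h3⟩ := exists_rotation t ht0
    refine ⟨_, rotation_orthogonal h1, Or.inr (Or.inl ⟨a, b, ?_⟩)⟩
    have hk2 : k * ((c - Complex.I * s) * (c - Complex.I * s)) = 1 / 2 := by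
      linear_combination (-(c - Complex.I * s) ^ 2 / 2) * ht +
        (((c - Complex.I * s) * t + 1) / 2) * h3
    rw [J2_eq]
    ext i j
    fin_cases i <;> fin_cases j <;>
      simp [Matrix.mul_apply, Fin.sum_univ_three] <;> grind

theorem hasOrthogonalJordanForm_of_block (p q r b : ℂ) :
    HasOrthogonalJordanForm !![p, q, 0; q, r, 0; 0, 0, b] := by
  have hI := Complex.I_mul_I
  by_cases hplus : p - r = 2 * Complex.I * q
  · convert hasOrthogonalJordanForm_of_block_isotropic (p - Complex.I * q) (Complex.I * q) b
      using 2
    ext i j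
    fin_cases i <;> fin_cases j <;> simp <;> grind
  by_cases hminus : p - r = -2 * Complex.I * q
  · have hR : !![(1 : ℂ), 0, 0; 0, -1, 0; 0, 0, 1]ᵀ * !![1, 0, 0; 0, -1, 0; 0, 0, 1] = 1 := by
      ext i j
      fin_cases i <;> fin_cases j <;> simp [Matrix.mul_apply, Fin.sum_univ_three]
    refine .of_conj hR ?_
    convert hasOrthogonalJordanForm_of_block_isotropic (p + Complex.I * q) (-Complex.I * q) b
      using 2
    ext i j
    fin_cases i <;> fin_cases j <;> simp [Matrix.mul_apply, Fin.sum_univ_three] <;> grind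
  by_cases hq : q = 0
  · refine ⟨1, by simp, Or.inl ⟨p, r, b, ?_⟩⟩
    subst hq
    ext i j
    fin_cases i <;> fin_cases j <;> simp
  obtain ⟨δ, hδ⟩ := IsAlgClosed.exists_pow_nat_eq ((r - p) ^ 2 + 4 * q ^ 2) (n := 2) (by norm_num)
  obtain ⟨μ, hμ⟩ : ∃ μ : ℂ, μ * μ - (r - p) * μ - q * q = 0 :=
    ⟨(r - p + δ) / 2, by linear_combination hδ / 4⟩
  have hnorm : q * q + μ * μ ≠ 0 := by
    intro h0
    have h1 : (μ - Complex.I * q) * (μ + Complex.I * q) = 0 := by grind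
    rcases mul_eq_zero.mp h1 with h | h
    · have h2 : q * (p - r - -2 * Complex.I * q) = 0 := by grind
      grind
    · have h2 : q * (p - r - 2 * Complex.I * q) = 0 := by grind
      grind
  obtain ⟨d, hd⟩ := IsAlgClosed.exists_pow_nat_eq (q * q + μ * μ) (n := 2) (by norm_num)
  have hd0 : d ≠ 0 := by rintro rfl; apply hnorm; simpa using hd.symm
  have h1 : q / d * (q / d) + μ / d * (μ / d) = 1 := by
    field_simp
    linear_combination -hd
  have h2 : q * (q / d * (q / d) - μ / d * (μ / d)) + (r - p) * (q / d * (μ / d)) = 0 := by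
    field_simp
    linear_combination -q * hμ
  generalize q / d = c at h1 h2
  generalize μ / d = s at h1 h2
  refine ⟨_, rotation_orthogonal h1, Or.inl ⟨p * c * c + 2 * q * c * s + r * s * s,
    p * s * s - 2 * q * c * s + r * c * c, b, ?_⟩⟩
  ext i j
  fin_cases i <;> fin_cases j <;> simp [Matrix.mul_apply, Fin.sum_univ_three] <;> grind

theorem conj_mulVec_eq {S R : Matrix (Fin 3) (Fin 3) ℂ} {v w : Fin 3 → ℂ} {l : ℂ}
    (hR : Rᵀ * R = 1) (hv : S *ᵥ v = l • v) (hRw : R *ᵥ w = v) :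
    (Rᵀ * S * R) *ᵥ w = l • w := by
  rw [← mulVec_mulVec, hRw, ← mulVec_mulVec, hv, mulVec_smul, ← hRw, mulVec_mulVec, hR,
    one_mulVec]

theorem hasOrthogonalJordanForm_of_nonisotropic {S : Matrix (Fin 3) (Fin 3) ℂ} (hS : Sᵀ = S)
    {v : Fin 3 → ℂ} {l : ℂ} (hv : S *ᵥ v = l • v) (hvv : v ⬝ᵥ v ≠ 0) :
    HasOrthogonalJordanForm S := by
  obtain ⟨d, hd⟩ := IsAlgClosed.exists_pow_nat_eq (v ⬝ᵥ v) (n := 2) (by norm_num)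
  have hd0 : d ≠ 0 := by rintro rfl; apply hvv; simpa using hd.symm
  obtain ⟨w, hw, hww⟩ : ∃ w : Fin 3 → ℂ, S *ᵥ w = l • w ∧ w ⬝ᵥ w = 1 := by
    refine ⟨d⁻¹ • v, by rw [mulVec_smul, hv, smul_comm], ?_⟩
    simp only [smul_dotProduct, dotProduct_smul, smul_eq_mul, ← hd]
    field_simp
  have he : e3 ⬝ᵥ e3 = 1 := by simp [e3]
  obtain ⟨R, hR, x, hx, hRx⟩ : ∃ R : Matrix (Fin 3) (Fin 3) ℂ, Rᵀ * R = 1 ∧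
      ∃ x, S *ᵥ x = l • x ∧ R *ᵥ e3 = x := by
    by_cases h : (w - e3) ⬝ᵥ (w - e3) = 0
    · obtain ⟨R, hR, hx⟩ := exists_orthogonal_mulVec_eq (v := -w) (w := e3)
        (by simp [hww, he]) (by
          simp only [sub_dotProduct, dotProduct_sub, neg_dotProduct, dotProduct_neg, hww, he,
            dotProduct_comm e3 w] at h ⊢
          grind)
      exact ⟨R, hR, -w, by rw [mulVec_neg, hw, smul_neg], hx⟩
    · obtain ⟨R, hR, hx⟩ := exists_orthogonal_mulVec_eq (hww.trans he.symm) h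
      exact ⟨R, hR, w, hw, hx⟩
  refine .of_conj hR ?_
  have hM := conj_mulVec_eq hR hx hRx
  have hMt : (Rᵀ * S * R)ᵀ = Rᵀ * S * R := by
    simp only [transpose_mul, transpose_transpose, hS, Matrix.mul_assoc]
  generalize Rᵀ * S * R = M at hM hMt
  have h02 := congrFun hM 0
  have h12 := congrFun hM 1
  simp [e3, mulVec, dotProduct, Fin.sum_univ_three] at h02 h12
  have hsymm : ∀ i j, M j i = M i j := fun i j ↦ congrFun (congrFun hMt i) j
  convert hasOrthogonalJordanForm_of_block (M 0 0) (M 0 1) (M 1 1) (M 2 2) using 1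
  ext i j
  fin_cases i <;> fin_cases j <;> simp [h02, h12, hsymm 0 1, hsymm 0 2, hsymm 1 2]

theorem hasOrthogonalJordanForm_of_nilpotent_part (l p q : ℂ) (hq : q ≠ 0) :
    HasOrthogonalJordanForm !![l + p, -Complex.I * p, q; -Complex.I * p, l - p, -Complex.I * q;
      q, -Complex.I * q, l] := by
  have hI := Complex.I_mul_I
  obtain ⟨m, rfl⟩ : ∃ m : ℂ, p = -2 * q * m := ⟨-p / (2 * q), by field_simp⟩
  let U : Matrix (Fin 3) (Fin 3) ℂ :=
    !![1 - m * m / 2, Complex.I * m * m / 2, -m;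
      Complex.I * m * m / 2, 1 + m * m / 2, Complex.I * m;
      m, -Complex.I * m, 1]
  have hU : Uᵀ * U = 1 := by
    ext i j
    fin_cases i <;> fin_cases j <;> simp [U, Matrix.mul_apply, Fin.sum_univ_three] <;> grind
  refine .of_conj hU ?_
  have hconj : Uᵀ * !![l + -2 * q * m, -Complex.I * (-2 * q * m), q;
      -Complex.I * (-2 * q * m), l - -2 * q * m, -Complex.I * q; q, -Complex.I * q, l] * U =
      !![l, 0, q; 0, l, -Complex.I * q; q, -Complex.I * q, l] := by
    ext i j
    fin_cases i <;> fin_cases j <;> simp [U, Matrix.mul_apply, Fin.sum_univ_three] <;> grind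
  rw [hconj]
  have hk : (Real.sqrt 2 : ℂ)⁻¹ ≠ 0 := by simp
  obtain ⟨c, s, h1, h2, h3⟩ := exists_rotation (q / (Real.sqrt 2 : ℂ)⁻¹) (div_ne_zero hq hk)
  refine ⟨_, rotation_orthogonal h1, Or.inr (Or.inr ⟨l, ?_⟩)⟩
  rw [J3_eq]
  generalize (Real.sqrt 2 : ℂ)⁻¹ = k at *
  have h4 : q * (c - Complex.I * s) = k := by
    field_simp at h3
    linear_combination h3
  ext i j
  fin_cases i <;> fin_cases j <;>
    simp [Matrix.mul_apply, Fin.sum_univ_three] <;> grind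

theorem hasOrthogonalJordanForm_of_standard_isotropic {S : Matrix (Fin 3) (Fin 3) ℂ}
    (hS : Sᵀ = S) {l : ℂ} (hv : S *ᵥ ![1, -Complex.I, 0] = l • ![1, -Complex.I, 0]) :
    HasOrthogonalJordanForm S := by
  have hI := Complex.I_mul_I
  have hsymm : ∀ i j, S j i = S i j := fun i j ↦ congrFun (congrFun hS i) j
  have h0 := congrFun hv 0
  have h1 := congrFun hv 1
  have h2 := congrFun hv 2
  simp [mulVec, dotProduct, Fin.sum_univ_three] at h0 h1 h2
  rw [hsymm 0 1] at h1
  rw [hsymm 0 2, hsymm 1 2] at h2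
  obtain ⟨p, hp⟩ : ∃ p, p = S 0 0 - l := ⟨_, rfl⟩
  obtain ⟨q, hq⟩ : ∃ q, q = S 0 2 := ⟨_, rfl⟩
  obtain ⟨a, ha⟩ : ∃ a, a = S 2 2 - l := ⟨_, rfl⟩
  have hSeq : S = !![l + p, -Complex.I * p, q; -Complex.I * p, l - p, -Complex.I * q;
      q, -Complex.I * q, l + a] := by
    ext i j
    fin_cases i <;> fin_cases j <;> simp [hsymm 0 1, hsymm 0 2, hsymm 1 2] <;> grind
  by_cases ha0 : a = 0
  · by_cases hq0 : q = 0
    · refine hasOrthogonalJordanForm_of_nonisotropic hS (v := e3) (l := l) ?_ (by simp [e3])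
      rw [hSeq]
      ext i
      fin_cases i <;> simp [e3, mulVec, dotProduct, Fin.sum_univ_three, ha0, hq0]
    · rw [hSeq, ha0, add_zero]
      exact hasOrthogonalJordanForm_of_nilpotent_part l p q hq0
  · refine hasOrthogonalJordanForm_of_nonisotropic hS (v := ![q, -Complex.I * q, a])
      (l := l + a) ?_ ?_
    · rw [hSeq]
      ext i
      fin_cases i <;> simp [mulVec, dotProduct, Fin.sum_univ_three] <;> grind
    · simp [dotProduct, Fin.sum_univ_three]
      grind

theorem hasOrthogonalJordanForm_of_symmetric {S : Matrix (Fin 3) (Fin 3) ℂ} (hS : Sᵀ = S) :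
    HasOrthogonalJordanForm S := by
  have hI := Complex.I_mul_I
  obtain ⟨l, hl⟩ := Module.End.exists_eigenvalue (toLin' S)
  obtain ⟨v, hv⟩ := hl.exists_hasEigenvector
  have hSv : S *ᵥ v = l • v := by simpa using hv.apply_eq_smul
  by_cases hvv : v ⬝ᵥ v = 0
  · set g : Fin 3 → ℂ := ![1, -Complex.I, 0] with hg
    have hgg : g ⬝ᵥ g = 0 := by simp [hg, dotProduct, Fin.sum_univ_three]
    by_cases hvg : v ⬝ᵥ g = 0
    · refine hasOrthogonalJordanForm_of_standard_isotropic hS (l := l) ?_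
      simp [hg, dotProduct, Fin.sum_univ_three] at hvg hvv
      have hv2 : v 2 = 0 := by
        have : v 2 * v 2 = 0 := by grind
        simpa using this
      have hvg' : v = v 0 • g := by
        ext i
        fin_cases i <;> simp [hg, hv2]
        grind
      have hv0 : v 0 ≠ 0 := fun h ↦ hv.2 (by rw [hvg', h, zero_smul])
      have hgv : g = (v 0)⁻¹ • v := by
        conv_rhs => rw [hvg']
        simp [hg, hv0]
      rw [← hg, hgv, mulVec_smul, hSv, smul_comm]
    · obtain ⟨R, hR, hRg⟩ := exists_orthogonal_mulVec_eq (hvv.trans hgg.symm) (by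
        simp only [sub_dotProduct, dotProduct_sub, hvv, hgg, dotProduct_comm g v]
        grind)
      refine .of_conj hR (hasOrthogonalJordanForm_of_standard_isotropic ?_
        (conj_mulVec_eq hR hSv hRg))
      simp only [transpose_mul, transpose_transpose, hS, Matrix.mul_assoc]
  · exact hasOrthogonalJordanForm_of_nonisotropic hS hSv hvv

/-- Every invertible complex 3×3 matrix has a singular value decomposition
`A = R₁ D R₂ᵀ` with `R₁, R₂` complex rotations, `D` symmetric, `DᵀD = D²`, and `D²` in
symmetric Jordan form. -/
theorem complex_svd (A : Matrix (Fin 3) (Fin 3) ℂ) (hA : A.det ≠ 0) :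
    ∃ R₁ R₂ D : Matrix (Fin 3) (Fin 3) ℂ,
      R₁ᵀ * R₁ = 1 ∧ R₂ᵀ * R₂ = 1 ∧ Dᵀ = D ∧ Dᵀ * D = D * D ∧
      IsSymmetricJordan (D * D) ∧ A = R₁ * D * R₂ᵀ := by
  obtain ⟨R, hR, hJ⟩ := hasOrthogonalJordanForm_of_symmetric (S := Aᵀ * A) (by simp)
  have hRdet : R.det ≠ 0 := fun h ↦ by simpa [h] using congrArg det hR
  obtain ⟨D, hDt, hD⟩ := hJ.exists_symmetric_sqrt (by simp [hA, hRdet])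
  have hDdet : IsUnit D.det := by
    rw [isUnit_iff_ne_zero]
    intro h
    have := congrArg det hD
    simp [h, hA, hRdet] at this
  refine ⟨A * R * D⁻¹, R, D, ?_, hR, hDt, by rw [hDt], hD ▸ hJ, ?_⟩
  · calc (A * R * D⁻¹)ᵀ * (A * R * D⁻¹) = D⁻¹ * (Rᵀ * (Aᵀ * A) * R) * D⁻¹ := by
          simp only [transpose_mul, transpose_nonsing_inv, hDt, Matrix.mul_assoc]
      _ = 1 := by
          rw [← hD, ← Matrix.mul_assoc, nonsing_inv_mul D hDdet, Matrix.one_mul,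
            mul_nonsing_inv D hDdet]
  · rw [nonsing_inv_mul_cancel_right _ _ hDdet, Matrix.mul_assoc, mul_eq_one_comm.mp hR,
      Matrix.mul_one]
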